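/- Let −∞ ≤ a < 0 < b ≤ ∞ and let w : (a,b) → (0,∞) be an integrable function such that x ↦ log w(x) is concave on (a,b), ∫_a^b w(x) dx = 1, and ∫_a^b x·w(x) dx = 0. Then ∫_a^0 w(x) dx ≥ e^{-1} and ∫_0^b w(x) dx ≥ e^{-1}. -/

import Mathlib

open MeasureTheory

/-- The set of real numbers lying strictly between two extended real numbers. -/
def erealIoo (a b : EReal) : Set ℝ := {x : ℝ | a < (x : EReal) ∧ (x : EReal) < b}

open Set Filter Topology

lemma isOpen_erealIoo (a b : EReal) : IsOpen (erealIoo a b) :=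
  (isOpen_lt continuous_const continuous_coe_real_ereal).inter
    (isOpen_lt continuous_coe_real_ereal continuous_const)

lemma ordConnected_erealIoo (a b : EReal) : OrdConnected (erealIoo a b) :=
  ⟨fun _ hx _ hy _ hz => ⟨hx.1.trans_le (EReal.coe_le_coe_iff.2 hz.1),
    (EReal.coe_le_coe_iff.2 hz.2).trans_lt hy.2⟩⟩

/-- The mass to the left of `x` of the measure with density `w` on `S`. -/
noncomputable def leftMass (S : Set ℝ) (w : ℝ → ℝ) (x : ℝ) : ℝ := ∫ t in S ∩ Iic x, w t

section LogConcave

variable {S : Set ℝ} {w : ℝ → ℝ}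

lemma continuousOn_of_concaveOn_log (hS : IsOpen S) (hw : ∀ x ∈ S, 0 < w x)
    (hconc : ConcaveOn ℝ S fun x => Real.log (w x)) : ContinuousOn w S :=
  (Real.continuous_exp.comp_continuousOn (hconc.continuousOn hS)).congr
    fun x hx => (Real.exp_log (hw x hx)).symm

lemma leftMass_pos (hS : IsOpen S) (hw : ∀ x ∈ S, 0 < w x) (hint : IntegrableOn w S)
    {x : ℝ} (hx : x ∈ S) : 0 < leftMass S w x := by
  have hm : MeasurableSet (S ∩ Iic x) := hS.measurableSet.inter measurableSet_Iic
  obtain ⟨l, hl, hlS⟩ := exists_Ioc_subset_of_mem_nhds (hS.mem_nhds hx) (exists_lt x)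
  rw [leftMass, setIntegral_pos_iff_support_of_nonneg_ae
    (ae_restrict_of_forall_mem hm fun t ht => (hw t ht.1).le) (hint.mono_set inter_subset_left)]
  refine lt_of_lt_of_le ?_ (measure_mono (s := Ioc l x)
    fun t ht => ⟨(hw t (hlS ht)).ne', hlS ht, ht.2⟩)
  simpa using hl

lemma leftMass_le (hS : IsOpen S) (hw : ∀ x ∈ S, 0 < w x) (hint : IntegrableOn w S)
    (x : ℝ) : leftMass S w x ≤ ∫ t in S, w t :=
  setIntegral_mono_set hint (ae_restrict_of_forall_mem hS.measurableSet fun t ht => (hw t ht).le)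
    inter_subset_left.eventuallyLE

lemma leftMass_sub_leftMass (hS : IsOpen S) (hint : IntegrableOn w S) (hS' : OrdConnected S)
    {x y : ℝ} (hx : x ∈ S) (hy : y ∈ S) :
    leftMass S w y - leftMass S w x = ∫ t in x..y, w t := by
  have h (z : ℝ) : leftMass S w z = ∫ t in Iic z, S.indicator w t := by
    rw [leftMass, setIntegral_indicator hS.measurableSet, inter_comm]
  have hI := (integrable_indicator_iff hS.measurableSet).2 hint
  rw [h, h, intervalIntegral.integral_Iic_sub_Iic hI.integrableOn hI.integrableOn]
  exact intervalIntegral.integral_congr fun t ht => indicator_of_mem (hS'.uIcc_subset hx hy ht) _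

lemma hasDerivAt_leftMass (hS : IsOpen S) (hS' : OrdConnected S) (hint : IntegrableOn w S)
    (hc : ContinuousOn w S) {x : ℝ} (hx : x ∈ S) : HasDerivAt (leftMass S w) (w x) x := by
  have h : HasDerivAt (fun y => ∫ t in x..y, w t) (w x) x :=
    intervalIntegral.integral_hasDerivAt_right (by simp)
      (hc.stronglyMeasurableAtFilter hS x hx) (hc.continuousAt (hS.mem_nhds hx))
  refine (h.add_const (leftMass S w x)).congr_of_eventuallyEq ?_
  filter_upwards [hS.mem_nhds hx] with y hy
  rw [← leftMass_sub_leftMass hS hint hS' hx hy]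
  ring

lemma mul_le_mul_of_concaveOn_log (hw : ∀ x ∈ S, 0 < w x)
    (hconc : ConcaveOn ℝ S fun x => Real.log (w x)) {t x y : ℝ} (ht : t ∈ S) (hy : y ∈ S)
    (htx : t ≤ x) (hxy : x < y) : w y * w t ≤ w x * w (t + (y - x)) := by
  have hd : 0 < y - t := by linarith
  have hS' : OrdConnected S := hconc.1.ordConnected
  have hx : x ∈ S := hS'.out ht hy ⟨htx, hxy.le⟩
  have hu : t + (y - x) ∈ S := hS'.out ht hy ⟨by linarith, by linarith⟩
  have hsum : (y - x) / (y - t) + (x - t) / (y - t) = 1 := by field_simp; ring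
  have h0 : 0 ≤ (y - x) / (y - t) := div_nonneg (by linarith) hd.le
  have h1 : 0 ≤ (x - t) / (y - t) := div_nonneg (by linarith) hd.le
  have e1 := hconc.2 ht hy h0 h1 hsum
  have e2 := hconc.2 ht hy h1 h0 (by rw [add_comm]; exact hsum)
  have hx' : (y - x) / (y - t) * t + (x - t) / (y - t) * y = x := by field_simp; ring
  have hu' : (x - t) / (y - t) * t + (y - x) / (y - t) * y = t + (y - x) := by
    field_simp; ring
  simp only [smul_eq_mul, hx', hu'] at e1 e2
  rw [← Real.log_le_log_iff (mul_pos (hw y hy) (hw t ht)) (mul_pos (hw x hx) (hw _ hu)),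
    Real.log_mul (hw y hy).ne' (hw t ht).ne', Real.log_mul (hw x hx).ne' (hw _ hu).ne']
  linear_combination e1 + e2 - (Real.log (w t) + Real.log (w y)) * hsum

lemma mul_leftMass_le (hS : IsOpen S) (hw : ∀ x ∈ S, 0 < w x) (hint : IntegrableOn w S)
    (hconc : ConcaveOn ℝ S fun x => Real.log (w x)) {x y : ℝ} (hx : x ∈ S) (hy : y ∈ S)
    (hxy : x < y) : w y * leftMass S w x ≤ w x * leftMass S w y := by
  have hm (z : ℝ) : MeasurableSet (S ∩ Iic z) := hS.measurableSet.inter measurableSet_Iic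
  have hI (z : ℝ) : Integrable ((S ∩ Iic z).indicator w) :=
    (integrable_indicator_iff (hm z)).2 (hint.mono_set inter_subset_left)
  rw [leftMass, leftMass, ← integral_indicator (hm x), ← integral_indicator (hm y),
    ← integral_add_right_eq_self ((S ∩ Iic y).indicator w) (y - x), ← integral_const_mul,
    ← integral_const_mul]
  refine integral_mono ((hI x).const_mul _) (((hI y).comp_add_right (y - x)).const_mul _)
    fun t => ?_
  by_cases ht : t ∈ S ∩ Iic x
  · have htx : t ≤ x := ht.2
    have hu : t + (y - x) ∈ S ∩ Iic y :=
      ⟨hconc.1.ordConnected.out ht.1 hy ⟨by linarith, by linarith⟩,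
        show t + (y - x) ≤ y by linarith⟩
    simp only [indicator_of_mem ht, indicator_of_mem hu]
    exact mul_le_mul_of_concaveOn_log hw hconc ht.1 hy htx hxy
  · simp only [indicator_of_notMem ht, mul_zero]
    exact mul_nonneg (hw x hx).le (indicator_nonneg (fun s hs => (hw s hs.1).le) _)

lemma concaveOn_log_leftMass (hS : IsOpen S) (hw : ∀ x ∈ S, 0 < w x) (hint : IntegrableOn w S)
    (hconc : ConcaveOn ℝ S fun x => Real.log (w x)) :
    ConcaveOn ℝ S fun x => Real.log (leftMass S w x) := by
  have hd : ∀ x ∈ S, HasDerivAt (fun x => Real.log (leftMass S w x)) (w x / leftMass S w x) x :=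
    fun x hx => (hasDerivAt_leftMass hS hconc.1.ordConnected hint
      (continuousOn_of_concaveOn_log hS hw hconc) hx).log (leftMass_pos hS hw hint hx).ne'
  refine AntitoneOn.concaveOn_of_deriv hconc.1
    (fun x hx => (hd x hx).continuousAt.continuousWithinAt)
    (fun x hx => (hd x (interior_subset hx)).differentiableAt.differentiableWithinAt) ?_
  rw [hS.interior_eq]
  intro x hx y hy hxy
  rw [(hd x hx).deriv, (hd y hy).deriv,
    div_le_div_iff₀ (leftMass_pos hS hw hint hy) (leftMass_pos hS hw hint hx)]
  rcases hxy.eq_or_lt with rfl | hlt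
  · rfl
  · exact mul_leftMass_le hS hw hint hconc hx hy hlt

lemma log_leftMass_le (hS : IsOpen S) (hw : ∀ x ∈ S, 0 < w x) (hint : IntegrableOn w S)
    (hconc : ConcaveOn ℝ S fun x => Real.log (w x)) (h0 : (0 : ℝ) ∈ S) {x : ℝ} (hx : x ∈ S) :
    Real.log (leftMass S w x) ≤ Real.log (leftMass S w 0) + w 0 / leftMass S w 0 * x := by
  have hc := concaveOn_log_leftMass hS hw hint hconc
  have hd : HasDerivAt (fun x => Real.log (leftMass S w x)) (w 0 / leftMass S w 0) 0 :=
    (hasDerivAt_leftMass hS hconc.1.ordConnected hint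
      (continuousOn_of_concaveOn_log hS hw hconc) h0).log (leftMass_pos hS hw hint h0).ne'
  rcases lt_trichotomy x 0 with h | rfl | h
  · have := hc.le_slope_of_hasDerivAt hx h0 h hd
    rw [slope_def_field, le_div_iff₀ (by linarith)] at this
    linarith
  · simp
  · have := hc.slope_le_of_hasDerivAt h0 hx h hd
    rw [slope_def_field, div_le_iff₀ (by linarith)] at this
    linarith

/-- The tangent bound for `log (leftMass S w)`, integrated against `w` over `[α, β]`. -/
lemma leftMass_mul_log_sub_le (hS : IsOpen S) (hw : ∀ x ∈ S, 0 < w x) (hint : IntegrableOn w S)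
    (hconc : ConcaveOn ℝ S fun x => Real.log (w x)) (h0 : (0 : ℝ) ∈ S) {α β : ℝ} (hα : α ∈ S)
    (hβ : β ∈ S) (hαβ : α ≤ β) :
    (leftMass S w β * Real.log (leftMass S w β) - leftMass S w β) -
        (leftMass S w α * Real.log (leftMass S w α) - leftMass S w α) ≤
      Real.log (leftMass S w 0) * (leftMass S w β - leftMass S w α) +
        w 0 / leftMass S w 0 * ∫ x in α..β, x * w x := by
  have hS' : OrdConnected S := hconc.1.ordConnected
  have hsub : uIcc α β ⊆ S := hS'.uIcc_subset hα hβ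
  have hcw : ContinuousOn w (uIcc α β) := (continuousOn_of_concaveOn_log hS hw hconc).mono hsub
  have hF : ∀ x ∈ S, HasDerivAt (leftMass S w) (w x) x := fun x hx =>
    hasDerivAt_leftMass hS hS' hint (continuousOn_of_concaveOn_log hS hw hconc) hx
  have hlog : ContinuousOn (fun x => w x * Real.log (leftMass S w x)) (uIcc α β) :=
    hcw.mul (ContinuousOn.log
      (fun x hx => (hF x (hsub hx)).continuousAt.continuousWithinAt)
      fun x hx => (leftMass_pos hS hw hint (hsub hx)).ne')
  have hxw : ContinuousOn (fun x => x * w x) (uIcc α β) := continuousOn_id.mul hcw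
  have hftc := intervalIntegral.integral_eq_sub_of_hasDerivAt
    (f := fun x => leftMass S w x * Real.log (leftMass S w x) - leftMass S w x)
    (f' := fun x => w x * Real.log (leftMass S w x)) (fun x hx => by
      have hp := (leftMass_pos hS hw hint (hsub hx)).ne'
      have hx' := hF x (hsub hx)
      convert! (hx'.mul (hx'.log hp)).sub hx' using 1
      field_simp
      ring) hlog.intervalIntegrable
  rw [← hftc, leftMass_sub_leftMass hS hint hS' hα hβ, ← intervalIntegral.integral_const_mul,
    ← intervalIntegral.integral_const_mul, ← intervalIntegral.integral_add
      (hcw.intervalIntegrable.const_mul _) (hxw.intervalIntegrable.const_mul _)]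
  refine intervalIntegral.integral_mono_on hαβ hlog.intervalIntegrable
    ((hcw.intervalIntegrable.const_mul _).add (hxw.intervalIntegrable.const_mul _))
    fun x hx => ?_
  have hxS := hsub (Icc_subset_uIcc hx)
  have := mul_le_mul_of_nonneg_left (log_leftMass_le hS hw hint hconc h0 hxS) (hw x hxS).le
  linarith

end LogConcave

lemma exists_seq_exhausting_erealIoo {a b : EReal} (ha : a < 0) (hb : 0 < b) :
    ∃ α β : ℕ → ℝ, (∀ n, α n ∈ erealIoo a b ∧ α n ≤ 0) ∧ (∀ n, β n ∈ erealIoo a b ∧ 0 ≤ β n) ∧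
      ∀ x ∈ erealIoo a b, ∀ᶠ n in atTop, x ∈ Ioc (α n) (β n) := by
  obtain ⟨u, -, hu, hul⟩ := exists_seq_strictAnti_tendsto' ha
  obtain ⟨v, -, hv, hvl⟩ := exists_seq_strictMono_tendsto' hb
  have hu' (n : ℕ) : ((u n).toReal : EReal) = u n :=
    EReal.coe_toReal ((hu n).2.trans EReal.zero_lt_top).ne ((bot_le.trans_lt (hu n).1)).ne'
  have hv' (n : ℕ) : ((v n).toReal : EReal) = v n :=
    EReal.coe_toReal ((hv n).2.trans_le le_top).ne (EReal.bot_lt_zero.trans (hv n).1).ne'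
  refine ⟨fun n => (u n).toReal, fun n => (v n).toReal, fun n => ⟨⟨?_, ?_⟩, ?_⟩,
    fun n => ⟨⟨?_, ?_⟩, ?_⟩, fun x hx => ?_⟩
  · rw [hu']; exact (hu n).1
  · rw [hu']; exact (hu n).2.trans hb
  · rw [← EReal.coe_le_coe_iff, hu']; exact (hu n).2.le
  · rw [hv']; exact ha.trans (hv n).1
  · rw [hv']; exact (hv n).2
  · rw [← EReal.coe_le_coe_iff, hv']; exact (hv n).1.le
  · filter_upwards [hul.eventually_lt_const hx.1, hvl.eventually_const_lt hx.2] with n h1 h2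
    constructor
    · rw [← EReal.coe_lt_coe_iff, hu']; exact h1
    · rw [← EReal.coe_le_coe_iff, hv']; exact h2.le

lemma Real.mul_log_sub_self_mem_Icc {x : ℝ} (h0 : 0 < x) (h1 : x ≤ 1) :
    x * Real.log x - x ∈ Icc (-1 : ℝ) 0 := by
  have hu := mul_nonpos_of_nonneg_of_nonpos h0.le (Real.log_nonpos h0.le h1)
  have hl := mul_le_mul_of_nonneg_left (Real.one_sub_inv_le_log_of_pos h0) h0.le
  rw [mul_sub, mul_inv_cancel₀ h0.ne'] at hl
  constructor <;> linarith

section Density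

variable {a b : EReal} {w : ℝ → ℝ}

lemma integrableOn_id_mul_Iic_zero (ha : a < 0) (hb : 0 < b)
    (hw : ∀ x ∈ erealIoo a b, 0 < w x) (hint : IntegrableOn w (erealIoo a b))
    (hconc : ConcaveOn ℝ (erealIoo a b) fun x => Real.log (w x))
    (hmass : ∫ x in erealIoo a b, w x = 1) :
    IntegrableOn (fun x => x * w x) (erealIoo a b ∩ Iic 0) := by
  set S := erealIoo a b
  have hS : IsOpen S := isOpen_erealIoo a b
  have hS' : OrdConnected S := ordConnected_erealIoo a b
  have h0 : (0 : ℝ) ∈ S := ⟨by simpa using ha, by simpa using hb⟩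
  have hp := leftMass_pos hS hw hint h0
  have hp1 : leftMass S w 0 ≤ 1 := hmass ▸ leftMass_le hS hw hint 0
  have hlp := Real.log_nonpos hp.le hp1
  set c := w 0 / leftMass S w 0
  have hc : 0 < c := div_pos (hw 0 h0) hp
  obtain ⟨α, β, hα, -, hcov⟩ := exists_seq_exhausting_erealIoo ha hb
  have hAE : AECover (volume.restrict (S ∩ Iic 0)) atTop (fun n => Ioc (α n) 0) :=
    ⟨ae_restrict_of_forall_mem (hS.measurableSet.inter measurableSet_Iic) fun x hx =>
      (hcov x hx.1).mono fun n hn => ⟨hn.1, hx.2⟩, fun n => measurableSet_Ioc⟩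
  have hsub (n : ℕ) : Icc (α n) 0 ⊆ S := hS'.out (hα n).1 h0
  have hrestr (n : ℕ) : (volume.restrict (S ∩ Iic 0)).restrict (Ioc (α n) 0) =
      volume.restrict (Ioc (α n) 0) := by
    rw [Measure.restrict_restrict measurableSet_Ioc, inter_eq_left.2]
    exact fun x hx => ⟨hsub n ⟨hx.1.le, hx.2⟩, hx.2⟩
  have hcont (n : ℕ) : ContinuousOn (fun x => x * w x) (Icc (α n) 0) :=
    continuousOn_id.mul ((continuousOn_of_concaveOn_log hS hw hconc).mono (hsub n))
  refine hAE.integrable_of_integral_norm_bounded ((1 - Real.log (leftMass S w 0)) / c) (fun n => ?_)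
    (Eventually.of_forall fun n => ?_)
  · rw [IntegrableOn, hrestr]
    exact (hcont n).integrableOn_Icc.mono_set Ioc_subset_Icc_self
  · have hineq := leftMass_mul_log_sub_le hS hw hint hconc h0 (hα n).1 h0 (hα n).2
    have hq := leftMass_pos hS hw hint (hα n).1
    have hq1 : leftMass S w (α n) ≤ 1 := hmass ▸ leftMass_le hS hw hint (α n)
    have b1 := Real.mul_log_sub_self_mem_Icc hp hp1
    have b2 := Real.mul_log_sub_self_mem_Icc hq hq1
    have hnorm : ∫ x in Ioc (α n) 0, ‖x * w x‖ = -∫ x in (α n)..0, x * w x := by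
      rw [intervalIntegral.integral_of_le (hα n).2, ← integral_neg]
      refine setIntegral_congr_fun measurableSet_Ioc fun x hx => ?_
      exact Real.norm_of_nonpos
        (mul_nonpos_of_nonpos_of_nonneg hx.2 (hw x (hsub n ⟨hx.1.le, hx.2⟩)).le)
    rw [hrestr, hnorm, le_div_iff₀ hc]
    have : Real.log (leftMass S w 0) * (leftMass S w 0 - leftMass S w (α n)) ≤
        - Real.log (leftMass S w 0) := by nlinarith
    linarith [b1.1, b2.2]

lemma exp_neg_one_le_setIntegral_inter_Iio (ha : a < 0) (hb : 0 < b)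
    (hw : ∀ x ∈ erealIoo a b, 0 < w x) (hint : IntegrableOn w (erealIoo a b))
    (hconc : ConcaveOn ℝ (erealIoo a b) fun x => Real.log (w x))
    (hmass : ∫ x in erealIoo a b, w x = 1)
    (hbarint : IntegrableOn (fun x => x * w x) (erealIoo a b))
    (hbar : ∫ x in erealIoo a b, x * w x = 0) :
    Real.exp (-1) ≤ ∫ x in erealIoo a b ∩ Iio (0 : ℝ), w x := by
  set S := erealIoo a b
  have hS : IsOpen S := isOpen_erealIoo a b
  have hS' : OrdConnected S := ordConnected_erealIoo a b
  have h0 : (0 : ℝ) ∈ S := ⟨by simpa using ha, by simpa using hb⟩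
  obtain ⟨α, β, hα, hβ, hcov⟩ := exists_seq_exhausting_erealIoo ha hb
  have hle (n : ℕ) : α n ≤ β n := (hα n).2.trans (hβ n).2
  have hAE : AECover (volume.restrict S) atTop (fun n => Ioc (α n) (β n)) :=
    ⟨ae_restrict_of_forall_mem hS.measurableSet hcov, fun n => measurableSet_Ioc⟩
  have hlim {g : ℝ → ℝ} (hg : IntegrableOn g S) :
      Tendsto (fun n => ∫ x in (α n)..(β n), g x) atTop (𝓝 (∫ x in S, g x)) := by
    refine (hAE.integral_tendsto_of_countably_generated hg).congr fun n => ?_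
    rw [Measure.restrict_restrict measurableSet_Ioc, inter_eq_left.2,
      intervalIntegral.integral_of_le (hle n)]
    exact Ioc_subset_Icc_self.trans (hS'.out (hα n).1 (hβ n).1)
  have hdiff : Tendsto (fun n => leftMass S w (β n) - leftMass S w (α n)) atTop (𝓝 1) := by
    rw [← hmass]
    exact (hlim hint).congr fun n =>
      (leftMass_sub_leftMass hS hint hS' (hα n).1 (hβ n).1).symm
  have hpos {x : ℝ} (hx : x ∈ S) := leftMass_pos hS hw hint hx
  have hle1 (x : ℝ) : leftMass S w x ≤ 1 := hmass ▸ leftMass_le hS hw hint x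
  have hβl : Tendsto (fun n => leftMass S w (β n)) atTop (𝓝 1) :=
    tendsto_of_tendsto_of_tendsto_of_le_of_le hdiff tendsto_const_nhds
      (fun n => by linarith [hpos (hα n).1]) (fun n => hle1 _)
  have hαl : Tendsto (fun n => leftMass S w (α n)) atTop (𝓝 0) := by
    simpa using hβl.sub hdiff
  have hΦ : Continuous fun x : ℝ => x * Real.log x - x := Real.continuous_mul_log.sub continuous_id
  have hineq := le_of_tendsto_of_tendsto'
    (((hΦ.tendsto 1).comp hβl).sub ((hΦ.tendsto 0).comp hαl))
    ((hdiff.const_mul (Real.log (leftMass S w 0))).add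
      ((hlim hbarint).const_mul (w 0 / leftMass S w 0)))
    (fun n => leftMass_mul_log_sub_le hS hw hint hconc h0 (hα n).1 (hβ n).1 (hle n))
  have hlog : -1 ≤ Real.log (leftMass S w 0) := by simpa [hbar] using hineq
  have hmain := (Real.le_log_iff_exp_le (hpos h0)).1 hlog
  rwa [leftMass, ← setIntegral_congr_set
    ((Filter.EventuallyEq.refl _ S).inter Iio_ae_eq_Iic)] at hmain

lemma neg_mem_erealIoo {x : ℝ} : -x ∈ erealIoo a b ↔ x ∈ erealIoo (-b) (-a) := by
  simp only [erealIoo, mem_ofPred_eq, EReal.coe_neg]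
  rw [EReal.lt_neg_comm, EReal.neg_lt_comm, and_comm]

lemma concaveOn_log_comp_neg (hconc : ConcaveOn ℝ (erealIoo a b) fun x => Real.log (w x)) :
    ConcaveOn ℝ (erealIoo (-b) (-a)) fun x => Real.log (w (-x)) := by
  have h := hconc.comp_linearMap (-LinearMap.id)
  have hpre : (-LinearMap.id : ℝ →ₗ[ℝ] ℝ) ⁻¹' erealIoo a b = erealIoo (-b) (-a) := by
    ext x; exact neg_mem_erealIoo
  rw [hpre] at h
  exact h

lemma setIntegral_comp_neg (s : Set ℝ) (g : ℝ → ℝ) :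
    ∫ x in Neg.neg ⁻¹' s, g (-x) = ∫ x in s, g x :=
  (Measure.measurePreserving_neg (volume : Measure ℝ)).setIntegral_preimage_emb
    (MeasurableEquiv.neg ℝ).measurableEmbedding g s

lemma integrableOn_comp_neg_iff {s : Set ℝ} {g : ℝ → ℝ} :
    IntegrableOn (fun x => g (-x)) (Neg.neg ⁻¹' s) ↔ IntegrableOn g s :=
  (Measure.measurePreserving_neg (volume : Measure ℝ)).integrableOn_comp_preimage
    (MeasurableEquiv.neg ℝ).measurableEmbedding

end Density

/-- One-dimensional Grünbaum inequality for log-concave densities: a log-concave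
probability density `w` on a (possibly unbounded) interval `(a,b)` with barycenter `0`
satisfies `∫_a^0 w ≥ e⁻¹` and `∫_0^b w ≥ e⁻¹`. -/
theorem grunbaum_one_dim_logconcave (a b : EReal) (w : ℝ → ℝ)
    (ha : a < (0 : EReal)) (hb : (0 : EReal) < b)
    (hw : ∀ x ∈ erealIoo a b, 0 < w x)
    (hint : IntegrableOn w (erealIoo a b))
    (hconc : ConcaveOn ℝ (erealIoo a b) (fun x => Real.log (w x)))
    (hmass : ∫ x in erealIoo a b, w x = 1)
    (hbar : ∫ x in erealIoo a b, x * w x = 0) :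
    Real.exp (-1) ≤ ∫ x in erealIoo a b ∩ Set.Iio (0 : ℝ), w x ∧
      Real.exp (-1) ≤ ∫ x in erealIoo a b ∩ Set.Ioi (0 : ℝ), w x := by
  have hpre : Neg.neg ⁻¹' erealIoo a b = erealIoo (-b) (-a) :=
    Set.ext fun x => neg_mem_erealIoo
  have ha' : -b < 0 := by simpa using EReal.neg_lt_neg_iff.2 hb
  have hb' : 0 < -a := by simpa using EReal.neg_lt_neg_iff.2 ha
  have hw' : ∀ x ∈ erealIoo (-b) (-a), 0 < w (-x) := fun x hx => hw _ (neg_mem_erealIoo.2 hx)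
  have hint' : IntegrableOn (fun x => w (-x)) (erealIoo (-b) (-a)) :=
    hpre ▸ integrableOn_comp_neg_iff.2 hint
  have hconc' := concaveOn_log_comp_neg hconc
  have hmass' : ∫ x in erealIoo (-b) (-a), w (-x) = 1 := by
    rw [← hpre, setIntegral_comp_neg, hmass]
  have hL := integrableOn_id_mul_Iic_zero ha hb hw hint hconc hmass
  have hR : IntegrableOn (fun x => x * w x) (erealIoo a b ∩ Ici 0) := by
    have h := (integrableOn_id_mul_Iic_zero ha' hb' hw' hint' hconc' hmass').neg
    rw [← integrableOn_comp_neg_iff, preimage_inter, hpre]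
    simpa [Pi.neg_def] using h
  have hbarint : IntegrableOn (fun x => x * w x) (erealIoo a b) := by
    simpa [← inter_union_distrib_left] using hL.union hR
  have hbarint' : IntegrableOn (fun x => x * w (-x)) (erealIoo (-b) (-a)) := by
    have h := (integrableOn_comp_neg_iff.2 hbarint).neg
    rw [hpre] at h
    simpa [Pi.neg_def] using h
  have hbar' : ∫ x in erealIoo (-b) (-a), x * w (-x) = 0 := by
    have h := setIntegral_comp_neg (erealIoo a b) fun x => x * w x
    rw [hpre, hbar] at h
    simpa [integral_neg] using h
  refine ⟨exp_neg_one_le_setIntegral_inter_Iio ha hb hw hint hconc hmass hbarint hbar, ?_⟩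
  have h := exp_neg_one_le_setIntegral_inter_Iio ha' hb' hw' hint' hconc' hmass' hbarint' hbar'
  rw [← setIntegral_comp_neg, preimage_inter, hpre]
  simpa using h
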